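/- Let ρ0 be the unique positive real root of x³ + 2x² + x − 1 and let C_e be the unique real root of 31x³ − 62x² + 35x − 3 (C_e ≈ 0.10381). Then the number e_n of Dyck paths with catastrophes of length n satisfies lim_{n→∞} e_n · ρ0ⁿ = C_e. -/

import Mathlib

open Filter Topology

/-- Validity of a path with catastrophes over the jump set `J`, starting from
altitude `h`: each step is either a jump `s ∈ J` keeping the altitude
nonnegative, or a catastrophe `s = -h` from an altitude `h > 0` with `-h ∉ J`
(landing at altitude `0`). -/
def CatValidFrom (J : Finset ℤ) : ℤ → List ℤ → Prop
  | _, [] => True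
  | h, s :: r =>
    ((s ∈ J ∧ 0 ≤ h + s) ∨ (s = -h ∧ 0 < h ∧ -h ∉ J)) ∧ CatValidFrom J (h + s) r

/-- The jump set of Dyck paths. For this jump set a catastrophe is a jump
`-h` from an altitude `h ≥ 2` to altitude `0`. -/
def dyckJ : Finset ℤ := {-1, 1}

/-- `l` is a Dyck path with catastrophes of length `n`. -/
def DyckCat (n : ℕ) (l : List ℤ) : Prop :=
  l.length = n ∧ CatValidFrom dyckJ 0 l ∧ l.sum = 0

/-- The number `e n` of Dyck paths with catastrophes of length `n`. -/
noncomputable def eCount (n : ℕ) : ℕ := Nat.card {l : List ℤ // DyckCat n l}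

open scoped PowerSeries in
/-- A family of power series that vanishes at `0` and satisfies the ballot recurrence is zero. -/
theorem PowerSeries.eq_zero_of_ballot_recurrence {R : Type*} [CommRing R] (B : ℕ → R⟦X⟧)
    (h0 : B 0 = 0) (hB : ∀ h, B (h + 1) = PowerSeries.X * (B (h + 2) + B h)) (h : ℕ) :
    B h = 0 := by
  ext n
  induction n generalizing h with
  | zero =>
    cases h with
    | zero => simp [h0]
    | succ h => simp [hB h]
  | succ n ih =>
    cases h with
    | zero => simp [h0]
    | succ h => simp [hB h, PowerSeries.coeff_succ_X_mul, ih]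

/-- A nonnegative sequence contracted up to a vanishing error tends to zero. -/
theorem tendsto_zero_of_le_mul_add {c ε : ℕ → ℝ} {r : ℝ} (hr0 : 0 ≤ r) (hr1 : r < 1)
    (hc0 : ∀ n, 0 ≤ c n) (hc : ∀ n, c (n + 1) ≤ r * c n + ε n)
    (hε : Tendsto ε atTop (𝓝 0)) : Tendsto c atTop (𝓝 0) := by
  rw [Metric.tendsto_atTop]
  intro δ hδ
  obtain ⟨N, hN⟩ := eventually_atTop.1
    (hε.eventually (gt_mem_nhds (show 0 < (1 - r) * (δ / 2) by nlinarith)))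
  have hbound : ∀ k, c (N + k) ≤ r ^ k * c N + δ / 2 := by
    intro k
    induction k with
    | zero => simp; linarith
    | succ k ih =>
      have h1 := hc (N + k)
      have h2 := hN (N + k) (by omega)
      have h3 := mul_le_mul_of_nonneg_left ih hr0
      rw [← add_assoc, pow_succ]
      nlinarith
  have hgeom : Tendsto (fun k : ℕ => r ^ k * c N) atTop (𝓝 0) := by
    simpa using (tendsto_pow_atTop_nhds_zero_of_lt_one hr0 hr1).mul_const (c N)
  obtain ⟨K, hK⟩ := eventually_atTop.1 (hgeom.eventually (gt_mem_nhds (half_pos hδ)))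
  refine ⟨N + K, fun n hn => ?_⟩
  obtain ⟨k, rfl⟩ := Nat.exists_eq_add_of_le (show N ≤ n by omega)
  have h1 := hbound k
  have h2 := hK k (by omega)
  rw [Real.dist_eq, sub_zero, abs_of_nonneg (hc0 _)]
  linarith

/-- The paths with catastrophes of length `n` from altitude `h` to altitude `0`. -/
def catPaths : ℕ → ℕ → Finset (List ℤ)
  | 0, 0 => {[]}
  | 0, _ + 1 => ∅
  | n + 1, 0 => (catPaths n 1).image (List.cons 1)
  | n + 1, 1 => (catPaths n 2).image (List.cons 1) ∪ (catPaths n 0).image (List.cons (-1))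
  | n + 1, h + 2 => ((catPaths n (h + 3)).image (List.cons 1) ∪
      (catPaths n (h + 1)).image (List.cons (-1))) ∪
      (catPaths n 0).image (List.cons (-(h + 2 : ℤ)))

theorem mem_catPaths (n h : ℕ) (l : List ℤ) :
    l ∈ catPaths n h ↔ l.length = n ∧ CatValidFrom dyckJ h l ∧ (h : ℤ) + l.sum = 0 := by
  induction n generalizing h l with
  | zero =>
    rw [List.length_eq_zero_iff]
    rcases h with _ | h
    · simp only [catPaths, Finset.mem_singleton]
      constructor
      · rintro rfl; simp [CatValidFrom]
      · exact fun h => h.1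
    · simp only [catPaths, Finset.notMem_empty, false_iff]
      rintro ⟨rfl, -, h2⟩
      simp at h2
      omega
  | succ n ih =>
    rcases l with _ | ⟨s, l⟩
    · rcases h with _ | _ | h <;> simp [catPaths]
    rcases h with _ | _ | h
    · simp only [catPaths, Finset.mem_image, List.cons.injEq, ih, CatValidFrom, dyckJ]
      constructor
      · rintro ⟨l, ⟨h1, h2, h3⟩, rfl, rfl⟩
        simp_all
      · rintro ⟨h1, ⟨h2, h3⟩, h4⟩
        obtain rfl : s = 1 := by simp at h2; omega
        refine ⟨l, ⟨by simpa using h1, by simpa using h3, by simpa using h4⟩, rfl, rfl⟩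
    · simp only [catPaths, Finset.mem_union, Finset.mem_image, List.cons.injEq, ih,
        CatValidFrom, dyckJ]
      constructor
      · rintro (⟨l, ⟨h1, h2, h3⟩, rfl, rfl⟩ | ⟨l, ⟨h1, h2, h3⟩, rfl, rfl⟩)
        · refine ⟨by simpa using h1, ⟨by simp, by simpa using h2⟩, ?_⟩
          rw [List.sum_cons]; push_cast at h3 ⊢; linarith
        · refine ⟨by simpa using h1, ⟨by simp, by simpa using h2⟩, ?_⟩
          rw [List.sum_cons]; push_cast at h3 ⊢; linarith
      · rintro ⟨h1, ⟨h2, h3⟩, h4⟩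
        have hs : s = 1 ∨ s = -1 := by simp at h2; omega
        rcases hs with rfl | rfl
        · refine Or.inl ⟨l, ⟨by simpa using h1, by simpa using h3, ?_⟩, rfl, rfl⟩
          rw [List.sum_cons] at h4; push_cast at h4 ⊢; linarith
        · refine Or.inr ⟨l, ⟨by simpa using h1, by simpa using h3, ?_⟩, rfl, rfl⟩
          rw [List.sum_cons] at h4; push_cast at h4 ⊢; linarith
    · have e1 : ((h + 2 : ℕ) : ℤ) + 1 = ((h + 3 : ℕ) : ℤ) := by push_cast; ring
      have e2 : ((h + 2 : ℕ) : ℤ) + -1 = ((h + 1 : ℕ) : ℤ) := by push_cast; ring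
      have e3 : ((h + 2 : ℕ) : ℤ) + -(h + 2 : ℤ) = ((0 : ℕ) : ℤ) := by push_cast; ring
      simp only [catPaths, Finset.mem_union, Finset.mem_image, List.cons.injEq, ih,
        CatValidFrom, dyckJ, List.sum_cons, ← add_assoc, List.length_cons, Nat.add_right_cancel_iff]
      constructor
      · rintro ((⟨l, ⟨h1, h2, h3⟩, rfl, rfl⟩ | ⟨l, ⟨h1, h2, h3⟩, rfl, rfl⟩) |
          ⟨l, ⟨h1, h2, h3⟩, rfl, rfl⟩)
        · rw [e1]; exact ⟨h1, ⟨Or.inl ⟨by simp, by positivity⟩, h2⟩, h3⟩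
        · rw [e2]; exact ⟨h1, ⟨Or.inl ⟨by simp, by positivity⟩, h2⟩, h3⟩
        · rw [e3]
          refine ⟨h1, ⟨Or.inr ⟨by push_cast; ring, by positivity, ?_⟩, h2⟩, h3⟩
          simp; omega
      · rintro ⟨h1, ⟨h2, h3⟩, h4⟩
        have hs : s = 1 ∨ s = -1 ∨ s = -(h + 2 : ℤ) := by simp at h2; omega
        rcases hs with rfl | rfl | rfl
        · rw [e1] at h3 h4; exact Or.inl (Or.inl ⟨l, ⟨h1, h3, h4⟩, rfl, rfl⟩)
        · rw [e2] at h3 h4; exact Or.inl (Or.inr ⟨l, ⟨h1, h3, h4⟩, rfl, rfl⟩)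
        · rw [e3] at h3 h4; exact Or.inr ⟨l, ⟨h1, h3, h4⟩, rfl, rfl⟩

theorem eCount_eq_card_catPaths (n : ℕ) : eCount n = (catPaths n 0).card := by
  rw [eCount, ← Nat.card_eq_finsetCard]
  refine Nat.card_congr (Equiv.subtypeEquivRight fun l => ?_)
  simp [DyckCat, mem_catPaths]

theorem disjoint_image_cons {α : Type*} [DecidableEq α] {a b : α} (hab : a ≠ b)
    (s t : Finset (List α)) : Disjoint (s.image (List.cons a)) (t.image (List.cons b)) := by
  rw [Finset.disjoint_left]
  intro l hs ht
  obtain ⟨l₁, -, rfl⟩ := Finset.mem_image.1 hs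
  obtain ⟨l₂, -, h⟩ := Finset.mem_image.1 ht
  exact hab (List.cons.inj h).1.symm

theorem card_catPaths_succ_zero (n : ℕ) :
    (catPaths (n + 1) 0).card = (catPaths n 1).card := by
  rw [catPaths, Finset.card_image_of_injective _ List.cons_injective]

theorem card_catPaths_succ_one (n : ℕ) :
    (catPaths (n + 1) 1).card = (catPaths n 2).card + (catPaths n 0).card := by
  rw [catPaths, Finset.card_union_of_disjoint (disjoint_image_cons (by norm_num) _ _)]
  simp only [Finset.card_image_of_injective _ List.cons_injective]

theorem card_catPaths_succ_add_two (n h : ℕ) :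
    (catPaths (n + 1) (h + 2)).card =
      (catPaths n (h + 3)).card + (catPaths n (h + 1)).card + (catPaths n 0).card := by
  rw [catPaths, Finset.card_union_of_disjoint, Finset.card_union_of_disjoint]
  · simp only [Finset.card_image_of_injective _ List.cons_injective]
  · exact disjoint_image_cons (by norm_num) _ _
  · rw [Finset.disjoint_union_left]
    exact ⟨disjoint_image_cons (by omega) _ _, disjoint_image_cons (by omega) _ _⟩

/-- The number of walks of length `n` with steps `±1` from altitude `1` whose first visit to
altitude `0` is their endpoint. -/
def firstPassage : ℕ → ℕ
  | 0 => 0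
  | n + 1 => (if n = 0 then 1 else 0) +
      ∑ i : Fin (n + 1), firstPassage i * firstPassage (n - i)

theorem firstPassage_zero : firstPassage 0 = 0 := by rw [firstPassage]

theorem firstPassage_succ (n : ℕ) :
    firstPassage (n + 1) = (if n = 0 then 1 else 0) +
      ∑ p ∈ Finset.HasAntidiagonal.antidiagonal n, firstPassage p.1 * firstPassage p.2 := by
  rw [firstPassage, Finset.Nat.sum_antidiagonal_eq_sum_range_succ
    (fun i j => firstPassage i * firstPassage j), Finset.sum_range]

open scoped PowerSeries

/-- The generating function of `firstPassage`. -/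
noncomputable def firstPassageSeries : ℝ⟦X⟧ := PowerSeries.mk fun n => (firstPassage n : ℝ)

theorem firstPassageSeries_eq :
    firstPassageSeries = PowerSeries.X * (1 + firstPassageSeries ^ 2) := by
  ext n
  cases n with
  | zero => simp [firstPassageSeries, firstPassage]
  | succ n =>
    rw [PowerSeries.coeff_succ_X_mul, firstPassageSeries, PowerSeries.coeff_mk, firstPassage_succ,
      map_add, PowerSeries.coeff_one, sq, PowerSeries.coeff_mul]
    push_cast
    simp

/-- The generating function of the paths with catastrophes from altitude `h` to altitude `0`. -/
noncomputable def catSeries (h : ℕ) : ℝ⟦X⟧ :=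
  PowerSeries.mk fun n => ((catPaths n h).card : ℝ)

theorem catSeries_zero : catSeries 0 = 1 + PowerSeries.X * catSeries 1 := by
  ext n
  cases n with
  | zero => simp [catSeries, catPaths]
  | succ n =>
    simp [catSeries, PowerSeries.coeff_succ_X_mul, card_catPaths_succ_zero, PowerSeries.coeff_one]

theorem catSeries_one : catSeries 1 = PowerSeries.X * (catSeries 2 + catSeries 0) := by
  ext n
  cases n with
  | zero => simp [catSeries, catPaths]
  | succ n => simp [catSeries, PowerSeries.coeff_succ_X_mul, card_catPaths_succ_one]

theorem catSeries_add_two (h : ℕ) : catSeries (h + 2) =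
    PowerSeries.X * (catSeries (h + 3) + catSeries (h + 1) + catSeries 0) := by
  ext n
  cases n with
  | zero => simp [catSeries, catPaths]
  | succ n => simp [catSeries, PowerSeries.coeff_succ_X_mul, card_catPaths_succ_add_two]

theorem catSeries_succ_eq (h : ℕ) :
    (1 - 2 * PowerSeries.X) * catSeries (h + 1) =
      PowerSeries.X * catSeries 0 * (1 - firstPassageSeries ^ (h + 1)) := by
  have hu := firstPassageSeries_eq
  have key := PowerSeries.eq_zero_of_ballot_recurrence
    (fun h => if h = 0 then 0 else (1 - 2 * PowerSeries.X) * catSeries h -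
      PowerSeries.X * catSeries 0 * (1 - firstPassageSeries ^ h)) (by simp) ?_ (h + 1)
  · simpa [sub_eq_zero] using key
  · rintro (_ | h)
    · simp only [zero_add, one_ne_zero, two_ne_zero, if_true, if_false]
      linear_combination (1 - 2 * PowerSeries.X) * catSeries_one +
        PowerSeries.X * catSeries 0 * hu
    · simp only [Nat.add_eq_zero_iff, one_ne_zero, two_ne_zero, and_false, if_false]
      linear_combination (1 - 2 * PowerSeries.X) * catSeries_add_two h +
        PowerSeries.X * catSeries 0 * firstPassageSeries ^ (h + 1) * hu

theorem one_sub_mul_catSeries_zero :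
    (1 - PowerSeries.X - 2 * PowerSeries.X ^ 2 - PowerSeries.X ^ 3) * catSeries 0 =
      1 - PowerSeries.X - PowerSeries.X ^ 2 - PowerSeries.X ^ 2 * firstPassageSeries := by
  have hne : (1 - 2 * PowerSeries.X : ℝ⟦X⟧) ≠ 0 := by
    intro h
    simpa using congrArg PowerSeries.constantCoeff h
  have h1 : catSeries 0 * (1 - 2 * PowerSeries.X - PowerSeries.X ^ 2 +
      PowerSeries.X ^ 2 * firstPassageSeries) = 1 - 2 * PowerSeries.X := by
    linear_combination (1 - 2 * PowerSeries.X) * catSeries_zero +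
      PowerSeries.X * catSeries_succ_eq 0
  apply mul_left_cancel₀ hne
  linear_combination (1 - PowerSeries.X - PowerSeries.X ^ 2 -
    PowerSeries.X ^ 2 * firstPassageSeries) * h1 -
    PowerSeries.X ^ 3 * catSeries 0 * firstPassageSeries_eq

theorem eCount_zero : eCount 0 = 1 := by
  simp [eCount_eq_card_catPaths, catPaths]

theorem eCount_one : eCount 1 = 0 := by
  simp [eCount_eq_card_catPaths, catPaths]

theorem eCount_two : eCount 2 = 1 := by
  simp [eCount_eq_card_catPaths, catPaths]

theorem eCount_add_three (n : ℕ) :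
    (eCount (n + 3) : ℝ) =
      eCount (n + 2) + 2 * eCount (n + 1) + eCount n - firstPassage (n + 1) := by
  have h := congrArg (PowerSeries.coeff (n + 3)) one_sub_mul_catSeries_zero
  have e : (1 - PowerSeries.X - 2 * PowerSeries.X ^ 2 - PowerSeries.X ^ 3) * catSeries 0 =
      catSeries 0 - PowerSeries.X * catSeries 0 -
        PowerSeries.X * (PowerSeries.X * (catSeries 0 + catSeries 0)) -
        PowerSeries.X * (PowerSeries.X * (PowerSeries.X * catSeries 0)) := by ring
  rw [e, sq (PowerSeries.X), mul_assoc] at h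
  simp [PowerSeries.coeff_succ_X_mul, PowerSeries.coeff_one, PowerSeries.coeff_X, catSeries,
    firstPassageSeries, ← eCount_eq_card_catPaths] at h
  linarith

theorem sum_antidiagonal_firstPassage (x : ℝ) (n : ℕ) :
    ∑ p ∈ Finset.HasAntidiagonal.antidiagonal n,
      ((firstPassage p.1 : ℝ) * x ^ p.1) * ((firstPassage p.2 : ℝ) * x ^ p.2) =
    (∑ p ∈ Finset.HasAntidiagonal.antidiagonal n, (firstPassage p.1 : ℝ) * firstPassage p.2) * x ^ n := by
  rw [Finset.sum_mul]
  refine Finset.sum_congr rfl fun p hp => ?_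
  rw [← Finset.HasAntidiagonal.mem_antidiagonal.1 hp, pow_add]
  ring

theorem sum_range_firstPassage_le {x u : ℝ} (hx : 0 ≤ x) (hu : 0 ≤ u)
    (hxu : x * (1 + u ^ 2) = u) (N : ℕ) :
    ∑ n ∈ Finset.range N, (firstPassage n : ℝ) * x ^ n ≤ u := by
  induction N with
  | zero => simpa
  | succ N ih =>
    set S := ∑ n ∈ Finset.range N, (firstPassage n : ℝ) * x ^ n with hS
    have hS0 : 0 ≤ S := Finset.sum_nonneg fun n _ => by positivity
    have hconv : ∑ n ∈ Finset.range N, ∑ p ∈ Finset.HasAntidiagonal.antidiagonal n,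
        ((firstPassage p.1 : ℝ) * x ^ p.1) * ((firstPassage p.2 : ℝ) * x ^ p.2) ≤ S ^ 2 := by
      rw [sq, hS, Finset.sum_mul_sum, ← Finset.sum_product']
      rw [Finset.sum_sigma', ← Finset.sum_image (s := (Finset.range N).sigma Finset.HasAntidiagonal.antidiagonal)
        (g := fun q => q.2) (f := fun p : ℕ × ℕ =>
          ((firstPassage p.1 : ℝ) * x ^ p.1) * ((firstPassage p.2 : ℝ) * x ^ p.2))]
      · refine Finset.sum_le_sum_of_subset_of_nonneg ?_ fun p _ _ => by positivity
        intro p hp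
        obtain ⟨⟨n, q⟩, hq, rfl⟩ := Finset.mem_image.1 hp
        simp only [Finset.mem_sigma, Finset.mem_range, Finset.HasAntidiagonal.mem_antidiagonal] at hq
        simp only [Finset.mem_product, Finset.mem_range]
        omega
      · rintro ⟨n, p⟩ hp ⟨m, q⟩ hq h
        simp only [Finset.coe_sigma, Set.mem_sigma_iff, Finset.mem_coe,
          Finset.HasAntidiagonal.mem_antidiagonal] at hp hq
        obtain rfl : p = q := h
        obtain rfl : n = m := hp.2.symm.trans hq.2
        rfl
    have hdelta : ∑ n ∈ Finset.range N, (if n = 0 then (1 : ℝ) else 0) * x ^ n ≤ 1 := by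
      rcases N with _ | N
      · simp
      · simp
    have hstep : ∑ n ∈ Finset.range (N + 1), (firstPassage n : ℝ) * x ^ n =
        x * (∑ n ∈ Finset.range N, (if n = 0 then (1 : ℝ) else 0) * x ^ n +
          ∑ n ∈ Finset.range N, ∑ p ∈ Finset.HasAntidiagonal.antidiagonal n,
            ((firstPassage p.1 : ℝ) * x ^ p.1) * ((firstPassage p.2 : ℝ) * x ^ p.2)) := by
      rw [Finset.sum_range_succ', ← Finset.sum_add_distrib, Finset.mul_sum]
      simp only [firstPassage_zero, Nat.cast_zero, zero_mul, add_zero]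
      refine Finset.sum_congr rfl fun n _ => ?_
      rw [sum_antidiagonal_firstPassage, firstPassage_succ]
      push_cast
      ring
    have hsq : S ^ 2 ≤ u ^ 2 := pow_le_pow_left₀ hS0 ih 2
    rw [hstep]
    calc _ ≤ x * (1 + u ^ 2) := mul_le_mul_of_nonneg_left (by linarith) hx
      _ = u := hxu

/-- The generating function of `firstPassage` evaluates to the small root of `u = x (1 + u²)`. -/
theorem hasSum_firstPassage {x u : ℝ} (hx : 0 < x) (hu : 0 ≤ u) (hu1 : u < 1)
    (hxu : x * (1 + u ^ 2) = u) :
    HasSum (fun n => (firstPassage n : ℝ) * x ^ n) u := by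
  have hnn : ∀ n, 0 ≤ (firstPassage n : ℝ) * x ^ n := fun n => by positivity
  have hs : Summable fun n => (firstPassage n : ℝ) * x ^ n :=
    summable_of_sum_range_le hnn (sum_range_firstPassage_le hx.le hu hxu)
  have hle : ∑' n, (firstPassage n : ℝ) * x ^ n ≤ u :=
    Real.tsum_le_of_sum_range_le hnn (sum_range_firstPassage_le hx.le hu hxu)
  set v := ∑' n, (firstPassage n : ℝ) * x ^ n with hv
  have hsq : HasSum (fun n => ∑ p ∈ Finset.HasAntidiagonal.antidiagonal n,
      ((firstPassage p.1 : ℝ) * x ^ p.1) * ((firstPassage p.2 : ℝ) * x ^ p.2)) (v ^ 2) := by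
    rw [sq, hv, tsum_mul_tsum_eq_tsum_sum_antidiagonal_of_summable_norm hs.norm hs.norm]
    exact (summable_norm_sum_mul_antidiagonal_of_summable_norm hs.norm hs.norm).of_norm.hasSum
  have hrec : HasSum (fun n => (firstPassage (n + 1) : ℝ) * x ^ (n + 1)) (x * (1 + v ^ 2)) := by
    have h1 : HasSum (fun n : ℕ => if n = 0 then (1 : ℝ) else 0) 1 := hasSum_ite_eq 0 1
    have h2 := (h1.add hsq).mul_left x
    refine Eq.mp (congrArg (HasSum · (x * (1 + v ^ 2))) (funext fun n => ?_)) h2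
    symm
    rw [sum_antidiagonal_firstPassage, firstPassage_succ]
    push_cast
    split_ifs with h
    · simp [h]; ring
    · ring
  have hveq : v = x * (1 + v ^ 2) := by
    rw [← hrec.tsum_eq, hv, hs.tsum_eq_zero_add, firstPassage_zero]
    simp
  have hfac : (u - v) * (1 - x * (u + v)) = 0 := by linear_combination -hveq - hxu
  have hlt : x * (u + v) < 1 := by nlinarith
  rcases mul_eq_zero.1 hfac with h | h
  · rw [sub_eq_zero.1 h]; exact hs.hasSum
  · linarith

/-- Uniqueness of the real root of `31x³ - 62x² + 35x - 3`. -/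
theorem cubic_root_unique {a b : ℝ} (ha : 31 * a ^ 3 - 62 * a ^ 2 + 35 * a - 3 = 0)
    (hb : 31 * b ^ 3 - 62 * b ^ 2 + 35 * b - 3 = 0) : a = b := by
  have bound : ∀ x : ℝ, 31 * x ^ 3 - 62 * x ^ 2 + 35 * x - 3 = 0 → x < 1 / 5 := by
    intro x hx
    by_contra! h
    nlinarith [mul_nonneg (sub_nonneg.2 h) (sq_nonneg (x - 9 / 10)), sq_nonneg (x - 9 / 10)]
  have h1 := bound a ha
  have h2 := bound b hb
  have h3 : (a - b) * (31 * (a ^ 2 + a * b + b ^ 2) - 62 * (a + b) + 35) = 0 := by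
    linear_combination ha - hb
  rcases mul_eq_zero.1 h3 with h | h
  · linarith
  · nlinarith [sq_nonneg (a + b), sq_nonneg a, sq_nonneg b]

/-- **Asymptotics of Dyck paths with catastrophes.** If `ρ0` is the (unique)
positive real root of `x³ + 2x² + x - 1` and `Cₑ` is the (unique) real root of
`31x³ - 62x² + 35x - 3` (`Cₑ ≈ 0.10381`), then `e_n · ρ0ⁿ → Cₑ`. -/
theorem eCount_asymptotics (ρ0 Ce : ℝ) (hρ0pos : 0 < ρ0)
    (hρ0 : ρ0 ^ 3 + 2 * ρ0 ^ 2 + ρ0 - 1 = 0)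
    (hCe : 31 * Ce ^ 3 - 62 * Ce ^ 2 + 35 * Ce - 3 = 0) :
    Tendsto (fun n : ℕ => (eCount n : ℝ) * ρ0 ^ n) atTop (𝓝 Ce) := by
  set u := √ρ0 with hu_def
  have hu0 : 0 < u := Real.sqrt_pos.2 hρ0pos
  have hρu : ρ0 = u ^ 2 := (Real.sq_sqrt hρ0pos.le).symm
  have hcub : u ^ 3 + u = 1 := by
    have h : (u ^ 3 + u) ^ 2 = 1 := by rw [hρu] at hρ0; linear_combination hρ0
    exact (pow_eq_one_iff_of_nonneg (by positivity) two_ne_zero).1 h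
  have hu1 : u < 7 / 10 := by
    by_contra! h
    nlinarith [pow_le_pow_left₀ (by norm_num) h 3]
  have hu2 : 67 / 100 < u := by
    by_contra! h
    nlinarith [pow_le_pow_left₀ hu0.le h 3]
  have hsum : HasSum (fun n => (firstPassage n : ℝ) * ρ0 ^ n) u :=
    hasSum_firstPassage hρ0pos hu0.le (by linarith) (by rw [hρu]; linear_combination u * hcub)
  set x : ℕ → ℝ := fun n => eCount n * ρ0 ^ n with hx
  have hrec : ∀ n, x (n + 3) = ρ0 * x (n + 2) + 2 * ρ0 ^ 2 * x (n + 1) + ρ0 ^ 3 * x n -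
      ρ0 ^ 2 * (firstPassage (n + 1) * ρ0 ^ (n + 1)) := by
    intro n
    simp only [hx, eCount_add_three]
    ring
  have hinv : ∀ n, x (n + 2) + (1 - ρ0) * x (n + 1) + ρ0 ^ 3 * x n = 1 - ρ0 - ρ0 ^ 2 -
      ρ0 ^ 2 * ∑ k ∈ Finset.range (n + 1), firstPassage k * ρ0 ^ k := by
    intro n
    induction n with
    | zero =>
      simp [hx, eCount_zero, eCount_one, eCount_two, firstPassage]
      linear_combination hρ0
    | succ n ih =>
      rw [Finset.sum_range_succ]
      linear_combination ih + hrec n + x (n + 1) * hρ0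
  set L := (2 - 2 * u - u ^ 2) / (3 - 2 * u) with hL
  have hL_mul : L * (3 - 2 * u) = 2 - 2 * u - u ^ 2 := div_mul_cancel₀ _ (by linarith)
  have hLC : L = Ce := by
    refine cubic_root_unique ?_ hCe
    have hne : (3 - 2 * u) ≠ 0 := by linarith
    rw [hL]
    field_simp
    linear_combination ((-53) * u ^ 0 + (15) * u ^ 1 + (-62) * u ^ 2 + (-31) * u ^ 3) * hcub
  rw [← hLC]
  set ε : ℕ → ℝ := fun n =>
    ρ0 ^ 2 * (u - ∑ k ∈ Finset.range (n + 1), firstPassage k * ρ0 ^ k) with hε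
  have hε0 : Tendsto ε atTop (𝓝 0) := by
    have h := ((hsum.tendsto_sum_nat.comp (tendsto_add_atTop_nat 1)).const_sub u).const_mul (ρ0 ^ 2)
    simpa [hε, Function.comp_def] using h
  have hdiff : ∀ n, x (n + 2) - L =
      -((1 - ρ0) * (x (n + 1) - L)) - ρ0 ^ 3 * (x n - L) + ε n := by
    intro n
    have h := hinv n
    simp only [hε]
    have e : (2 - ρ0 + ρ0 ^ 3) * L = 1 - ρ0 - ρ0 ^ 2 - ρ0 ^ 2 * u := by
      rw [hρu]
      linear_combination hL_mul + (L * (u ^ 3 - u + 1) + u ^ 2 + u - 1) * hcub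
    linear_combination h - e
  have hρ_lt : ρ0 < 1 / 2 := by rw [hρu]; nlinarith
  have hρ_gt : 44 / 100 < ρ0 := by rw [hρu]; nlinarith
  have hρ3 : ρ0 ^ 3 < 1 / 8 := by
    have := pow_lt_pow_left₀ hρ_lt hρ0pos.le three_ne_zero
    norm_num at this ⊢
    exact this
  have hc : Tendsto (fun n => |x (n + 1) - L| + 1 / 5 * |x n - L|) atTop (𝓝 0) := by
    refine tendsto_zero_of_le_mul_add (r := 4 / 5) (ε := fun n => |ε n|) (by norm_num)
      (by norm_num) (fun n => by positivity) (fun n => ?_) (by simpa using hε0.abs)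
    have h1 : |x (n + 2) - L| ≤ (1 - ρ0) * |x (n + 1) - L| + ρ0 ^ 3 * |x n - L| + |ε n| := by
      rw [hdiff n]
      refine (abs_add_le _ _).trans (add_le_add_left ((abs_sub _ _).trans_eq ?_) _)
      rw [abs_neg, abs_mul, abs_mul, abs_of_pos (show 0 < 1 - ρ0 by linarith),
        abs_of_pos (pow_pos hρ0pos 3)]
    nlinarith [abs_nonneg (x (n + 1) - L), abs_nonneg (x n - L)]
  have habs : Tendsto (fun n => |x (n + 1) - L|) atTop (𝓝 0) :=
    squeeze_zero (fun n => abs_nonneg _)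
      (fun n => le_add_of_nonneg_right (by positivity)) hc
  have hsub := tendsto_zero_iff_abs_tendsto_zero _ |>.2 habs
  rw [← tendsto_add_atTop_iff_nat 1]
  simpa using hsub.add_const L
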